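/- With the notation of the context, suppose the system A₁X₁ = C₁, X₁B₁ = C₂, A₂X₂ = C₃, X₂B₂ = C₄, A₃X₁B₃ + A₄X₂B₄ = C_c is consistent. Then (X₁, X₂) is a solution if and only if there exist quaternion matrices U, V, W, Z of appropriate sizes such that X₁ = A₁†C₁ + L_{A₁}C₂B₁† + L_{A₁}A†EB†R_{B₁} − L_{A₁}A†CM†R_A E B†R_{B₁} − L_{A₁}A†SC†E L_B N†D B†R_{B₁} − L_{A₁}A†S V R_N D B†R_{B₁} + L_{A₁}(L_A U + Z R_B)R_{B₁} and X₂ = A₂†C₃ + L_{A₂}C₄B₂† + L_{A₂}M†R_A E D†R_{B₂} + L_{A₂}L_M S†S C†E L_B N†R_{B₂} + L_{A₂}L_M (V − S†S V N N†)R_{B₂} + L_{A₂}W R_D R_{B₂}. -/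

import Mathlib

open scoped Quaternion Classical
open Matrix

noncomputable section

/-- The four Moore–Penrose conditions for `X` to be the Moore–Penrose inverse of `A`
over the real quaternions. -/
def IsMP {m n : Type*} [Fintype m] [Fintype n]
    (A : Matrix m n ℍ[ℝ]) (X : Matrix n m ℍ[ℝ]) : Prop :=
  A * X * A = A ∧ X * A * X = X ∧ (A * X)ᴴ = A * X ∧ (X * A)ᴴ = X * A

/-- The Moore–Penrose inverse `A†` of a quaternion matrix (it exists and is unique). -/
def dg {m n : Type*} [Fintype m] [Fintype n]
    (A : Matrix m n ℍ[ℝ]) : Matrix n m ℍ[ℝ] :=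
  if h : ∃ X, IsMP A X then h.choose else 0

/-- `L_A = I - A† A`. -/
def lproj {m n : Type*} [Fintype m] [Fintype n] [DecidableEq n]
    (A : Matrix m n ℍ[ℝ]) : Matrix n n ℍ[ℝ] :=
  1 - dg A * A

/-- `R_A = I - A A†`. -/
def rproj {m n : Type*} [Fintype m] [Fintype n] [DecidableEq m]
    (A : Matrix m n ℍ[ℝ]) : Matrix m m ℍ[ℝ] :=
  1 - A * dg A

/-- A quaternion matrix with vanishing Gram matrix vanishes. -/
theorem eq_zero_of_conjTranspose_mul_self_eq_zero {m n : Type*} [Fintype m]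
    {Z : Matrix m n ℍ[ℝ]} (h : Zᴴ * Z = 0) : Z = 0 := by
  ext1 i j
  have hj : ∑ k, Quaternion.normSq (Z k j) = 0 := by
    have h0 := congrFun (congrFun h j) j
    simp only [Matrix.mul_apply, Matrix.conjTranspose_apply, Matrix.zero_apply,
      Quaternion.star_mul_self] at h0
    apply (algebraMap ℝ ℍ[ℝ]).injective
    rw [map_sum, map_zero]
    exact h0
  rw [Finset.sum_eq_zero_iff_of_nonneg fun _ _ => Quaternion.normSq_nonneg] at hj
  exact Quaternion.normSq_eq_zero.1 (hj i (Finset.mem_univ i))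

/-- Every linear map between vector spaces over a division ring has an inner inverse. -/
theorem LinearMap.exists_comp_comp_eq_self {K V W : Type*} [DivisionRing K] [AddCommGroup V]
    [Module K V] [AddCommGroup W] [Module K W] (f : V →ₗ[K] W) :
    ∃ g : W →ₗ[K] V, f ∘ₗ g ∘ₗ f = f := by
  obtain ⟨r, hr⟩ := f.rangeRestrict.exists_rightInverse_of_surjective f.range_rangeRestrict
  obtain ⟨l, hl⟩ := (LinearMap.range f).subtype.exists_leftInverse_of_injective
    (Submodule.ker_subtype _)
  refine ⟨r ∘ₗ l, LinearMap.ext fun x => ?_⟩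
  have h1 : l (f x) = f.rangeRestrict x := LinearMap.congr_fun hl (f.rangeRestrict x)
  have h2 := congrArg Subtype.val (LinearMap.congr_fun hr (f.rangeRestrict x))
  simpa [h1] using h2

/-- Every matrix over a division ring has an inner inverse. -/
theorem Matrix.exists_mul_mul_eq_self {K m n : Type*} [DivisionRing K] [Fintype m] [Fintype n]
    (A : Matrix m n K) : ∃ X : Matrix n m K, A * X * A = A := by
  obtain ⟨g, hg⟩ := (Matrix.toLinearMapRight' A).exists_comp_comp_eq_self
  refine ⟨LinearMap.toMatrixRight' g, Matrix.toLinearMapRight'.injective ?_⟩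
  simpa [Matrix.toLinearMapRight'_mul, LinearMap.comp_assoc] using hg

/-- Every quaternion matrix `A` has an inner inverse `X` for which `A * X` is Hermitian. -/
theorem exists_inner_inverse_hermitian {m n : Type*} [Fintype m] [Fintype n]
    (A : Matrix m n ℍ[ℝ]) :
    ∃ X : Matrix n m ℍ[ℝ], A * X * A = A ∧ (A * X)ᴴ = A * X := by
  obtain ⟨g, hg⟩ := (Aᴴ * A).exists_mul_mul_eq_self
  have h1 : A * g * Aᴴ * A = A := by
    rw [← sub_eq_zero]
    refine eq_zero_of_conjTranspose_mul_self_eq_zero ?_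
    have h0 : Aᴴ * (A * g * Aᴴ * A - A) = 0 := by
      simpa [Matrix.mul_sub, Matrix.mul_assoc, sub_eq_zero] using hg
    have h2 : A * g * Aᴴ * A - A = A * (g * Aᴴ * A - 1) := by
      simp [Matrix.mul_sub, Matrix.mul_assoc]
    conv_lhs => enter [1]; rw [h2, Matrix.conjTranspose_mul]
    rw [Matrix.mul_assoc, h0, Matrix.mul_zero]
  have h2 : Aᴴ * (A * (gᴴ * Aᴴ)) = Aᴴ := by
    simpa [Matrix.mul_assoc] using congrArg Matrix.conjTranspose h1
  refine ⟨g * Aᴴ, by simpa [Matrix.mul_assoc] using h1, ?_⟩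
  have h3 : A * (gᴴ * Aᴴ) = A * (g * Aᴴ) := by
    calc A * (gᴴ * Aᴴ) = A * g * Aᴴ * A * (gᴴ * Aᴴ) := by rw [h1]
      _ = A * (g * (Aᴴ * (A * (gᴴ * Aᴴ)))) := by simp only [Matrix.mul_assoc]
      _ = A * (g * Aᴴ) := by rw [h2]
  simpa [Matrix.mul_assoc] using h3

/-- The Moore–Penrose inverse of a quaternion matrix exists. -/
theorem exists_isMP {m n : Type*} [Fintype m] [Fintype n] (A : Matrix m n ℍ[ℝ]) :
    ∃ X, IsMP A X := by
  obtain ⟨X, hX, hX'⟩ := exists_inner_inverse_hermitian A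
  obtain ⟨Y, hY, hY'⟩ := exists_inner_inverse_hermitian Aᴴ
  have hZ : A * Yᴴ * A = A := by
    simpa [Matrix.mul_assoc] using congrArg Matrix.conjTranspose hY
  have hZ' : (Yᴴ * A)ᴴ = Yᴴ * A := by
    simpa using hY'.symm
  have h1 : A * (Yᴴ * A * X) = A * X := by
    rw [← Matrix.mul_assoc, ← Matrix.mul_assoc, hZ]
  have h2 : Yᴴ * A * X * A = Yᴴ * A := by
    rw [Matrix.mul_assoc Yᴴ, Matrix.mul_assoc Yᴴ, hX]
  refine ⟨Yᴴ * A * X, by rw [h1, hX], ?_, by rw [h1, hX'], by rw [h2, hZ']⟩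
  rw [h2, ← Matrix.mul_assoc, ← Matrix.mul_assoc, Matrix.mul_assoc Yᴴ, Matrix.mul_assoc Yᴴ, hZ]

theorem mul_dg_mul_self {m n : Type*} [Fintype m] [Fintype n] (A : Matrix m n ℍ[ℝ]) :
    A * (dg A * A) = A := by
  rw [← Matrix.mul_assoc, dg, dif_pos (exists_isMP A)]
  exact (exists_isMP A).choose_spec.1

theorem mul_dg_mul_self_mul {m n k : Type*} [Fintype m] [Fintype n] (A : Matrix m n ℍ[ℝ])
    (X : Matrix n k ℍ[ℝ]) : A * (dg A * (A * X)) = A * X := by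
  rw [← Matrix.mul_assoc (dg A), ← Matrix.mul_assoc, mul_dg_mul_self]

theorem mul_lproj_self {m n : Type*} [Fintype m] [Fintype n] [DecidableEq n]
    (A : Matrix m n ℍ[ℝ]) : A * lproj A = 0 := by
  rw [lproj, Matrix.mul_sub, mul_dg_mul_self, Matrix.mul_one, sub_self]

theorem rproj_mul_self {m n : Type*} [Fintype m] [Fintype n] [DecidableEq m]
    (A : Matrix m n ℍ[ℝ]) : rproj A * A = 0 := by
  rw [rproj, Matrix.sub_mul, Matrix.mul_assoc, mul_dg_mul_self, Matrix.one_mul, sub_self]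

theorem mul_lproj_self_mul {m n k : Type*} [Fintype m] [Fintype n] [DecidableEq n]
    (A : Matrix m n ℍ[ℝ]) (X : Matrix n k ℍ[ℝ]) : A * (lproj A * X) = 0 := by
  rw [← Matrix.mul_assoc, mul_lproj_self, Matrix.zero_mul]

theorem rproj_mul_self_mul {m n k : Type*} [Fintype m] [Fintype n] [DecidableEq m]
    (A : Matrix m n ℍ[ℝ]) (X : Matrix n k ℍ[ℝ]) : rproj A * (A * X) = 0 := by
  rw [← Matrix.mul_assoc, rproj_mul_self, Matrix.zero_mul]

theorem lproj_mul {m n k : Type*} [Fintype m] [Fintype n] [DecidableEq n]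
    (A : Matrix m n ℍ[ℝ]) (X : Matrix n k ℍ[ℝ]) : lproj A * X = X - dg A * (A * X) := by
  rw [lproj, Matrix.sub_mul, Matrix.one_mul, Matrix.mul_assoc]

theorem rproj_mul {m n k : Type*} [Fintype m] [Fintype n] [DecidableEq m]
    (A : Matrix m n ℍ[ℝ]) (X : Matrix m k ℍ[ℝ]) : rproj A * X = X - A * (dg A * X) := by
  rw [rproj, Matrix.sub_mul, Matrix.one_mul, Matrix.mul_assoc]

theorem mul_rproj {m n k : Type*} [Fintype m] [Fintype n] [DecidableEq m]
    (A : Matrix m n ℍ[ℝ]) (X : Matrix k m ℍ[ℝ]) : X * rproj A = X - X * (A * dg A) := by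
  rw [rproj, Matrix.mul_sub, Matrix.mul_one]

theorem mul_dg_mul_mul_of_eq_mul_lproj {p c e k : Type*} [Fintype p] [Fintype c] [Fintype e]
    [DecidableEq c] {C S : Matrix p c ℍ[ℝ]} {M : Matrix e c ℍ[ℝ]} (hS : S = C * lproj M)
    (X : Matrix c k ℍ[ℝ]) : C * (dg M * (M * X)) = C * X - S * X := by
  rw [hS, Matrix.mul_assoc, lproj_mul, Matrix.mul_sub, sub_sub_cancel]

theorem mul_dg_mul_mul_of_eq_rproj_mul {p a c k : Type*} [Fintype p] [Fintype a] [Fintype c]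
    [DecidableEq p] [DecidableEq c] {A : Matrix p a ℍ[ℝ]} {C M S : Matrix p c ℍ[ℝ]}
    (hM : M = rproj A * C) (hS : S = C * lproj M) (X : Matrix c k ℍ[ℝ]) :
    S * (dg C * (C * X)) = S * X := by
  have h := mul_dg_mul_mul_of_eq_mul_lproj hS (dg C * (C * X))
  have hMC : M * (dg C * (C * X)) = M * X := by
    rw [hM, Matrix.mul_assoc, mul_dg_mul_self_mul, Matrix.mul_assoc]
  rw [hMC, mul_dg_mul_self_mul, mul_dg_mul_mul_of_eq_mul_lproj hS] at h
  exact (sub_right_injective h).symm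

section

variable {p q a b c d : Type*} [Fintype p] [Fintype q] [Fintype a] [Fintype b] [Fintype c]
  [Fintype d] [DecidableEq p] [DecidableEq q] [DecidableEq a] [DecidableEq b] [DecidableEq c]
  [DecidableEq d]

/-- If `A * Y * B + C * X * D = E` is consistent, the parametrized matrices solve it. -/
theorem isSolution_of_parametrization
    {A : Matrix p a ℍ[ℝ]} {B : Matrix b q ℍ[ℝ]} {C : Matrix p c ℍ[ℝ]} {D : Matrix d q ℍ[ℝ]}
    {E : Matrix p q ℍ[ℝ]} {M : Matrix p c ℍ[ℝ]} {N : Matrix d q ℍ[ℝ]} {S : Matrix p c ℍ[ℝ]}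
    (hM : M = rproj A * C) (hN : N = D * lproj B) (hS : S = C * lproj M)
    {Y₀ : Matrix a b ℍ[ℝ]} {X₀ : Matrix c d ℍ[ℝ]} (hE : A * Y₀ * B + C * X₀ * D = E)
    (U Z : Matrix a b ℍ[ℝ]) (V W : Matrix c d ℍ[ℝ]) :
    A * (dg A * E * dg B - dg A * C * dg M * rproj A * E * dg B
        - dg A * S * dg C * E * lproj B * dg N * D * dg B - dg A * S * V * rproj N * D * dg B
        + (lproj A * U + Z * rproj B)) * B
      + C * (dg M * rproj A * E * dg D + lproj M * dg S * S * dg C * E * lproj B * dg N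
        + lproj M * (V - dg S * S * V * N * dg N) + W * rproj D) * D = E := by
  have rAC : ∀ X : Matrix c q ℍ[ℝ], rproj A * (C * X) = M * X := fun X => by
    rw [hM, Matrix.mul_assoc]
  have AC : ∀ X : Matrix c q ℍ[ℝ], A * (dg A * (C * X)) = C * X - M * X := fun X => by
    rw [hM, Matrix.mul_assoc, rproj_mul, sub_sub_cancel]
  have ClM : ∀ X : Matrix c q ℍ[ℝ], C * (lproj M * X) = S * X := fun X => by
    rw [hS, Matrix.mul_assoc]
  have AS : ∀ X : Matrix c q ℍ[ℝ], A * (dg A * (S * X)) = S * X := fun X => by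
    rw [← ClM, AC, mul_lproj_self_mul, sub_zero]
  have DB : D * (dg B * B) = D - N := by
    rw [hN, lproj, Matrix.mul_sub, Matrix.mul_one, sub_sub_cancel]
  have DlB : ∀ X : Matrix q q ℍ[ℝ], D * (lproj B * X) = N * X := fun X => by
    rw [hN, Matrix.mul_assoc]
  subst hE
  simp only [Matrix.mul_add, Matrix.add_mul, Matrix.mul_sub, Matrix.sub_mul, Matrix.mul_assoc,
    rAC, rproj_mul_self_mul, mul_lproj_self_mul, AC, mul_dg_mul_mul_of_eq_mul_lproj hS, ClM, AS,
    mul_dg_mul_mul_of_eq_rproj_mul hM hS, DB, DlB, rproj_mul N, mul_dg_mul_self,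
    mul_dg_mul_self_mul, rproj_mul_self, Matrix.mul_zero, zero_add, add_zero]
  abel

/-- Every solution of `A * Y * B + C * X * D = E` is of the parametrized form. -/
theorem parametrization_of_isSolution
    {A : Matrix p a ℍ[ℝ]} {B : Matrix b q ℍ[ℝ]} {C : Matrix p c ℍ[ℝ]} {D : Matrix d q ℍ[ℝ]}
    {E : Matrix p q ℍ[ℝ]} {M : Matrix p c ℍ[ℝ]} {N : Matrix d q ℍ[ℝ]} {S : Matrix p c ℍ[ℝ]}
    (hM : M = rproj A * C) (hN : N = D * lproj B) (hS : S = C * lproj M)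
    {Y : Matrix a b ℍ[ℝ]} {X : Matrix c d ℍ[ℝ]} (hE : A * Y * B + C * X * D = E) :
    ∃ (U : Matrix a b ℍ[ℝ]) (V W : Matrix c d ℍ[ℝ]) (Z : Matrix a b ℍ[ℝ]),
      Y = dg A * E * dg B - dg A * C * dg M * rproj A * E * dg B
        - dg A * S * dg C * E * lproj B * dg N * D * dg B - dg A * S * V * rproj N * D * dg B
        + (lproj A * U + Z * rproj B) ∧
      X = dg M * rproj A * E * dg D + lproj M * dg S * S * dg C * E * lproj B * dg N
        + lproj M * (V - dg S * S * V * N * dg N) + W * rproj D := by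
  have rAC : ∀ T : Matrix c b ℍ[ℝ], rproj A * (C * T) = M * T := fun T => by
    rw [hM, Matrix.mul_assoc]
  have rAC' : ∀ T : Matrix c d ℍ[ℝ], rproj A * (C * T) = M * T := fun T => by
    rw [hM, Matrix.mul_assoc]
  have DlB : ∀ T : Matrix q b ℍ[ℝ], D * (lproj B * T) = N * T := fun T => by
    rw [hN, Matrix.mul_assoc]
  have DlB' : ∀ T : Matrix q d ℍ[ℝ], D * (lproj B * T) = N * T := fun T => by
    rw [hN, Matrix.mul_assoc]
  subst hE
  refine ⟨Y, X, dg M * M * X, dg A * A * Y, ?_, ?_⟩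
  · simp only [Matrix.mul_add, Matrix.add_mul, Matrix.mul_sub, Matrix.mul_assoc,
      rAC, rproj_mul_self_mul, mul_lproj_self_mul, mul_dg_mul_mul_of_eq_mul_lproj hS,
      mul_dg_mul_mul_of_eq_rproj_mul hM hS, DlB, rproj_mul N, lproj_mul A,
      mul_rproj B, Matrix.sub_mul, Matrix.mul_zero, zero_add]
    abel
  · simp only [Matrix.mul_add, Matrix.add_mul, Matrix.mul_sub, Matrix.mul_assoc,
      rAC', rproj_mul_self_mul, mul_lproj_self_mul,
      mul_dg_mul_mul_of_eq_rproj_mul hM hS, DlB', lproj_mul M,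
      mul_rproj D, Matrix.sub_mul, Matrix.mul_zero, zero_add]
    abel

end

/-- A common solution of `A * X = C` and `X * B = F` splits along the projections. -/
theorem eq_add_add_of_mul_eq {m n k s : Type*} [Fintype m] [Fintype n] [Fintype k] [Fintype s]
    [DecidableEq n] [DecidableEq k] {A : Matrix m n ℍ[ℝ]} {X : Matrix n k ℍ[ℝ]}
    {C : Matrix m k ℍ[ℝ]} {B : Matrix k s ℍ[ℝ]} {F : Matrix n s ℍ[ℝ]}
    (hA : A * X = C) (hB : X * B = F) :
    X = dg A * C + lproj A * F * dg B + lproj A * X * rproj B := by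
  subst hA hB
  simp only [Matrix.mul_assoc, lproj_mul, mul_rproj, Matrix.mul_sub, Matrix.sub_mul]
  abel

/-- If `A * X = C` and `X * B = F` have a common solution, the matrices
`dg A * C + lproj A * F * dg B + lproj A * Y * rproj B` are common solutions. -/
theorem mul_eq_and_mul_eq_of_eq_add_add {m n k s : Type*} [Fintype m] [Fintype n] [Fintype k]
    [Fintype s] [DecidableEq n] [DecidableEq k] {A : Matrix m n ℍ[ℝ]} {X₀ X : Matrix n k ℍ[ℝ]}
    {C : Matrix m k ℍ[ℝ]} {B : Matrix k s ℍ[ℝ]} {F : Matrix n s ℍ[ℝ]}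
    (hA : A * X₀ = C) (hB : X₀ * B = F) {Y : Matrix n k ℍ[ℝ]}
    (hX : X = dg A * C + lproj A * F * dg B + lproj A * Y * rproj B) :
    A * X = C ∧ X * B = F := by
  subst hA hB hX
  constructor
  · simp only [Matrix.mul_add, Matrix.mul_assoc, mul_dg_mul_self_mul, mul_lproj_self_mul, add_zero]
  · simp only [Matrix.add_mul, Matrix.mul_assoc, mul_dg_mul_self, rproj_mul_self, Matrix.mul_zero,
      lproj_mul, Matrix.sub_mul]
    abel

/-- General solution of the system (1.4) of the paper, assuming consistency. -/
theorem quat_system_two_unknowns_twoSided_general_solution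
    {p q m₁ a b s₁ m₂ c d s₂ : ℕ}
    (A₁ : Matrix (Fin m₁) (Fin a) ℍ[ℝ]) (C₁ : Matrix (Fin m₁) (Fin b) ℍ[ℝ])
    (B₁ : Matrix (Fin b) (Fin s₁) ℍ[ℝ]) (C₂ : Matrix (Fin a) (Fin s₁) ℍ[ℝ])
    (A₂ : Matrix (Fin m₂) (Fin c) ℍ[ℝ]) (C₃ : Matrix (Fin m₂) (Fin d) ℍ[ℝ])
    (B₂ : Matrix (Fin d) (Fin s₂) ℍ[ℝ]) (C₄ : Matrix (Fin c) (Fin s₂) ℍ[ℝ])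
    (A₃ : Matrix (Fin p) (Fin a) ℍ[ℝ]) (B₃ : Matrix (Fin b) (Fin q) ℍ[ℝ])
    (A₄ : Matrix (Fin p) (Fin c) ℍ[ℝ]) (B₄ : Matrix (Fin d) (Fin q) ℍ[ℝ])
    (Cc : Matrix (Fin p) (Fin q) ℍ[ℝ])
    (hcons : ∃ (X₁ : Matrix (Fin a) (Fin b) ℍ[ℝ]) (X₂ : Matrix (Fin c) (Fin d) ℍ[ℝ]),
        A₁ * X₁ = C₁ ∧ X₁ * B₁ = C₂ ∧
        A₂ * X₂ = C₃ ∧ X₂ * B₂ = C₄ ∧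
        A₃ * X₁ * B₃ + A₄ * X₂ * B₄ = Cc) :
    let A := A₃ * lproj A₁
    let B := rproj B₁ * B₃
    let C := A₄ * lproj A₂
    let D := rproj B₂ * B₄
    let M := rproj A * C
    let N := D * lproj B
    let S := C * lproj M
    let E := Cc - A₃ * dg A₁ * C₁ * B₃ - A * C₂ * dg B₁ * B₃
        - A₄ * dg A₂ * C₃ * B₄ - C * C₄ * dg B₂ * B₄
    ∀ (X₁ : Matrix (Fin a) (Fin b) ℍ[ℝ]) (X₂ : Matrix (Fin c) (Fin d) ℍ[ℝ]),
      (A₁ * X₁ = C₁ ∧ X₁ * B₁ = C₂ ∧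
       A₂ * X₂ = C₃ ∧ X₂ * B₂ = C₄ ∧
       A₃ * X₁ * B₃ + A₄ * X₂ * B₄ = Cc) ↔
        ∃ (U : Matrix (Fin a) (Fin b) ℍ[ℝ]) (V : Matrix (Fin c) (Fin d) ℍ[ℝ])
          (W : Matrix (Fin c) (Fin d) ℍ[ℝ]) (Z : Matrix (Fin a) (Fin b) ℍ[ℝ]),
          X₁ = dg A₁ * C₁ + lproj A₁ * C₂ * dg B₁ + lproj A₁ * dg A * E * dg B * rproj B₁
              - lproj A₁ * dg A * C * dg M * rproj A * E * dg B * rproj B₁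
              - lproj A₁ * dg A * S * dg C * E * lproj B * dg N * D * dg B * rproj B₁
              - lproj A₁ * dg A * S * V * rproj N * D * dg B * rproj B₁
              + lproj A₁ * (lproj A * U + Z * rproj B) * rproj B₁ ∧
          X₂ = dg A₂ * C₃ + lproj A₂ * C₄ * dg B₂
              + lproj A₂ * dg M * rproj A * E * dg D * rproj B₂
              + lproj A₂ * lproj M * dg S * S * dg C * E * lproj B * dg N * rproj B₂
              + lproj A₂ * lproj M * (V - dg S * S * V * N * dg N) * rproj B₂
              + lproj A₂ * W * rproj D * rproj B₂ := by
  intro A B C D M N S E X₁ X₂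
  have key : ∀ (Y₁ T₁ : Matrix (Fin a) (Fin b) ℍ[ℝ]) (Y₂ T₂ : Matrix (Fin c) (Fin d) ℍ[ℝ]),
      Y₁ = dg A₁ * C₁ + lproj A₁ * C₂ * dg B₁ + lproj A₁ * T₁ * rproj B₁ →
      Y₂ = dg A₂ * C₃ + lproj A₂ * C₄ * dg B₂ + lproj A₂ * T₂ * rproj B₂ →
      (A₃ * Y₁ * B₃ + A₄ * Y₂ * B₄ = Cc ↔ A * T₁ * B + C * T₂ * D = E) := by
    rintro Y₁ T₁ Y₂ T₂ rfl rfl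
    rw [← sub_eq_zero, ← sub_eq_zero (b := E)]
    refine Eq.congr_left ?_
    simp only [A, B, C, D, E, Matrix.mul_add, Matrix.add_mul, Matrix.mul_assoc]
    abel
  obtain ⟨P₁, P₂, hP₁, hP₁', hP₂, hP₂', hP⟩ := hcons
  have hE := (key _ _ _ _ (eq_add_add_of_mul_eq hP₁ hP₁') (eq_add_add_of_mul_eq hP₂ hP₂')).1 hP
  constructor
  · rintro ⟨h₁, h₁', h₂, h₂', h⟩
    have e₁ := eq_add_add_of_mul_eq h₁ h₁'
    have e₂ := eq_add_add_of_mul_eq h₂ h₂'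
    obtain ⟨U, V, W, Z, hX₁, hX₂⟩ := parametrization_of_isSolution (M := M) (N := N) (S := S)
      rfl rfl rfl ((key _ _ _ _ e₁ e₂).1 h)
    refine ⟨U, V, W, Z, ?_, ?_⟩
    · conv_lhs => rw [e₁, hX₁]
      simp only [Matrix.mul_add, Matrix.add_mul, Matrix.mul_sub, Matrix.sub_mul, Matrix.mul_assoc]
      abel
    · conv_lhs => rw [e₂, hX₂]
      simp only [Matrix.mul_add, Matrix.add_mul, Matrix.mul_sub, Matrix.sub_mul, Matrix.mul_assoc]
      abel
  · rintro ⟨U, V, W, Z, hX₁, hX₂⟩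
    have hs := isSolution_of_parametrization (M := M) (N := N) (S := S) rfl rfl rfl hE U Z V W
    have e₁ : X₁ = dg A₁ * C₁ + lproj A₁ * C₂ * dg B₁ + lproj A₁ * (dg A * E * dg B
        - dg A * C * dg M * rproj A * E * dg B
        - dg A * S * dg C * E * lproj B * dg N * D * dg B - dg A * S * V * rproj N * D * dg B
        + (lproj A * U + Z * rproj B)) * rproj B₁ := by
      rw [hX₁]
      simp only [Matrix.mul_add, Matrix.add_mul, Matrix.mul_sub, Matrix.sub_mul, Matrix.mul_assoc]
      abel
    have e₂ : X₂ = dg A₂ * C₃ + lproj A₂ * C₄ * dg B₂ + lproj A₂ * (dg M * rproj A * E * dg D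
        + lproj M * dg S * S * dg C * E * lproj B * dg N
        + lproj M * (V - dg S * S * V * N * dg N) + W * rproj D) * rproj B₂ := by
      rw [hX₂]
      simp only [Matrix.mul_add, Matrix.add_mul, Matrix.mul_sub, Matrix.sub_mul, Matrix.mul_assoc]
      abel
    have r₁ := mul_eq_and_mul_eq_of_eq_add_add hP₁ hP₁' e₁
    have r₂ := mul_eq_and_mul_eq_of_eq_add_add hP₂ hP₂' e₂
    exact ⟨r₁.1, r₁.2, r₂.1, r₂.2, (key _ _ _ _ e₁ e₂).2 hs⟩
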